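/- dim H^3_k(m_0) = 0 for k < 9, and for k ≥ 9: dim H^3_k(m_0) = l-1 if k = 6l + r with r ∈ {0,1,2,4}, and dim H^3_k(m_0) = l if k = 6l + r with r ∈ {3,5}. -/

import Mathlib

variable (K : Type*) [Field K] [CharZero K]

/-- The cochain `e^i` (for `i ≥ 1`) dual to the basis vector `e_i` of the Lie algebra
`m₀` (basis `e_1, e_2, ...`, brackets `[e_1, e_i] = e_{i+1}` for `i ≥ 2`); the cochain
complex of `m₀` is the exterior algebra on the span of the `e^i`, `i ≥ 1`. -/
noncomputable def e (i : ℕ) : ExteriorAlgebra K (ℕ →₀ K) :=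
  ExteriorAlgebra.ι K (Finsupp.single (i - 1) (1 : K))

/-- The monomial cochain `e^{i_1} ∧ ... ∧ e^{i_q}`. -/
noncomputable def mono (s : Finset ℕ) : ExteriorAlgebra K (ℕ →₀ K) :=
  ((s.sort (· ≤ ·)).map (e K)).prod

/-- `C^q_k`: the span of the `q`-cochains `e^{i_1} ∧ ... ∧ e^{i_q}`,
`1 ≤ i_1 < ... < i_q`, of weight `i_1 + ... + i_q = k`. -/
noncomputable def LamWt (q k : ℕ) : Submodule K (ExteriorAlgebra K (ℕ →₀ K)) :=
  Submodule.span K {x | ∃ s : Finset ℕ,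
    s.card = q ∧ (∀ i ∈ s, 1 ≤ i) ∧ (∑ i ∈ s, i) = k ∧ x = mono K s}

/-- `C^q`: the span of the `q`-cochains `e^{i_1} ∧ ... ∧ e^{i_q}` (all weights). -/
noncomputable def LamDeg (q : ℕ) : Submodule K (ExteriorAlgebra K (ℕ →₀ K)) :=
  Submodule.span K {x | ∃ s : Finset ℕ,
    s.card = q ∧ (∀ i ∈ s, 1 ≤ i) ∧ x = mono K s}

open Finset

set_option linter.unusedSectionVars false

section Counting

/-- The `q`-element sets of positive integers with sum `k`. -/
def wtSets (q k : ℕ) : Finset (Finset ℕ) :=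
  ((range (k + 1)).powersetCard q).filter fun s => (∀ i ∈ s, 1 ≤ i) ∧ ∑ i ∈ s, i = k

/-- The sets in `wtSets q k` containing `1`. -/
def wtSetsOne (q k : ℕ) : Finset (Finset ℕ) := (wtSets q k).filter (1 ∈ ·)

/-- The pairs `(a, b)` with `2 ≤ a < b < n - a - b`. -/
def wtPairs (n : ℕ) : Finset (ℕ × ℕ) :=
  (range (n + 1) ×ˢ range (n + 1)).filter fun p => 2 ≤ p.1 ∧ p.1 < p.2 ∧ p.1 + 2 * p.2 < n

lemma mem_wtSets {q k : ℕ} {s : Finset ℕ} :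
    s ∈ wtSets q k ↔ s.card = q ∧ (∀ i ∈ s, 1 ≤ i) ∧ ∑ i ∈ s, i = k := by
  simp only [wtSets, mem_filter, mem_powersetCard]
  refine ⟨fun h => ⟨h.1.2, h.2⟩, fun h => ⟨⟨fun i hi => ?_, h.1⟩, h.2⟩⟩
  have := single_le_sum (f := fun i : ℕ => i) (fun _ _ => Nat.zero_le _) hi
  rw [mem_range]
  omega

lemma mem_wtSetsOne {q k : ℕ} {s : Finset ℕ} :
    s ∈ wtSetsOne q k ↔ s ∈ wtSets q k ∧ 1 ∈ s := mem_filter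

lemma mem_wtPairs {n a b : ℕ} :
    (a, b) ∈ wtPairs n ↔ 2 ≤ a ∧ a < b ∧ a + 2 * b < n := by
  simp only [wtPairs, mem_filter, mem_product, mem_range]
  omega

lemma exists_lt_of_card_eq_two {s : Finset ℕ} (h : s.card = 2) :
    ∃ a b, a < b ∧ s = {a, b} := by
  obtain ⟨a, b, hab, rfl⟩ := card_eq_two.mp h
  rcases hab.lt_or_gt with h | h
  · exact ⟨a, b, h, rfl⟩
  · exact ⟨b, a, h, pair_comm a b⟩

lemma exists_lt_lt_of_card_eq_three {s : Finset ℕ} (h : s.card = 3) :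
    ∃ a b c, a < b ∧ b < c ∧ s = {a, b, c} := by
  have hne : s.Nonempty := card_pos.mp (by omega)
  have hmin := min'_mem s hne
  obtain ⟨b, c, hbc, hs⟩ := exists_lt_of_card_eq_two
    (s := s.erase (s.min' hne)) (by rw [card_erase_of_mem hmin]; omega)
  refine ⟨s.min' hne, b, c, ?_, hbc, ?_⟩
  · exact min'_lt_of_mem_erase_min' s hne (by rw [hs]; simp)
  · rw [← hs, insert_erase hmin]

lemma sum_triple {a b c : ℕ} (hab : a < b) (hbc : b < c) :
    ∑ i ∈ ({a, b, c} : Finset ℕ), i = a + b + c := by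
  rw [sum_insert, sum_pair hbc.ne, add_assoc]
  simp only [mem_insert, mem_singleton]
  omega

lemma card_triple {a b c : ℕ} (hab : a < b) (hbc : b < c) :
    ({a, b, c} : Finset ℕ).card = 3 :=
  card_eq_three.mpr ⟨a, b, c, hab.ne, (hab.trans hbc).ne, hbc.ne, rfl⟩

lemma triple_mem_wtSets {a b c k : ℕ} (ha : 1 ≤ a) (hab : a < b) (hbc : b < c)
    (h : a + b + c = k) : {a, b, c} ∈ wtSets 3 k := by
  refine mem_wtSets.mpr ⟨card_triple hab hbc, ?_, by rw [sum_triple hab hbc, h]⟩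
  simp only [mem_insert, mem_singleton]
  omega

lemma quadruple_mem_wtSetsOne {a b c k : ℕ} (ha : 1 < a) (hab : a < b) (hbc : b < c)
    (h : a + b + c + 1 = k) : {1, a, b, c} ∈ wtSetsOne 4 k := by
  have h1 : (1 : ℕ) ∉ ({a, b, c} : Finset ℕ) := by
    simp only [mem_insert, mem_singleton]
    omega
  refine mem_wtSetsOne.mpr ⟨mem_wtSets.mpr ⟨?_, ?_, ?_⟩, mem_insert_self _ _⟩
  · rw [card_insert_of_notMem h1, card_triple hab hbc]
  · simp only [mem_insert, mem_singleton]
    omega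
  · rw [sum_insert h1, sum_triple hab hbc]
    omega

lemma exists_of_mem_wtSetsOne_three {k : ℕ} {s : Finset ℕ} (hs : s ∈ wtSetsOne 3 k) :
    ∃ a b, 1 < a ∧ a < b ∧ a + b + 1 = k ∧ s = {1, a, b} := by
  obtain ⟨hs, h1⟩ := mem_wtSetsOne.mp hs
  obtain ⟨hc, hpos, hsum⟩ := mem_wtSets.mp hs
  obtain ⟨x, a, b, hxa, hab, rfl⟩ := exists_lt_lt_of_card_eq_three hc
  rw [sum_triple hxa hab] at hsum
  have := hpos x (by simp)
  obtain rfl : x = 1 := by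
    simp only [mem_insert, mem_singleton] at h1
    omega
  exact ⟨a, b, hxa, hab, by omega, rfl⟩

lemma exists_of_mem_wtSetsOne_four {k : ℕ} {s : Finset ℕ} (hs : s ∈ wtSetsOne 4 k) :
    ∃ a b c, 1 < a ∧ a < b ∧ b < c ∧ a + b + c + 1 = k ∧ s = {1, a, b, c} := by
  obtain ⟨hs, h1⟩ := mem_wtSetsOne.mp hs
  obtain ⟨hc, hpos, hsum⟩ := mem_wtSets.mp hs
  obtain ⟨a, b, c, hab, hbc, he⟩ := exists_lt_lt_of_card_eq_three
    (s := s.erase 1) (by rw [card_erase_of_mem h1, hc])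
  have ha : a ∈ s.erase 1 := by simp [he]
  have := hpos a (mem_of_mem_erase ha)
  have := ne_of_mem_erase ha
  rw [← add_sum_erase s _ h1, he, sum_triple hab hbc] at hsum
  exact ⟨a, b, c, by omega, hab, hbc, by omega, by rw [← he, insert_erase h1]⟩

lemma triple_inj {a b c a' b' c' : ℕ} (hab : a < b) (hbc : b < c) (hab' : a' < b')
    (hbc' : b' < c') (h : ({a, b, c} : Finset ℕ) = {a', b', c'}) : a = a' ∧ b = b' := by
  simp only [Finset.ext_iff, mem_insert, mem_singleton] at h
  have := h a
  have := h b
  have := h c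
  have := h a'
  have := h b'
  have := h c'
  omega

lemma card_wtSets_three_filter (n : ℕ) :
    ((wtSets 3 n).filter (1 ∉ ·)).card = (wtPairs n).card := by
  symm
  refine card_bij (fun p _ => {p.1, p.2, n - p.1 - p.2}) ?_ ?_ ?_
  · rintro ⟨a, b⟩ h
    obtain ⟨h2, hab, h⟩ := mem_wtPairs.mp h
    refine mem_filter.mpr
      ⟨triple_mem_wtSets (by omega) hab (by omega) (by omega), ?_⟩
    simp only [mem_insert, mem_singleton]
    omega
  · rintro ⟨a, b⟩ h ⟨a', b'⟩ h' heq
    obtain ⟨h2, hab, h⟩ := mem_wtPairs.mp h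
    obtain ⟨h2', hab', h'⟩ := mem_wtPairs.mp h'
    obtain ⟨rfl, rfl⟩ := triple_inj hab (by omega) hab' (by omega) heq
    rfl
  · intro s hs
    obtain ⟨hs, h1⟩ := mem_filter.mp hs
    obtain ⟨hc, hpos, hsum⟩ := mem_wtSets.mp hs
    obtain ⟨a, b, c, hab, hbc, rfl⟩ := exists_lt_lt_of_card_eq_three hc
    rw [sum_triple hab hbc] at hsum
    have := hpos a (by simp)
    simp only [mem_insert, mem_singleton] at h1
    refine ⟨(a, b), mem_wtPairs.mpr (by omega), ?_⟩
    simp only [show n - a - b = c by omega]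

lemma card_wtSetsOne_four (n : ℕ) : (wtSetsOne 4 (n + 1)).card = (wtPairs n).card := by
  rw [← card_wtSets_three_filter]
  refine card_bij (fun s _ => s.erase 1) ?_ ?_ ?_
  · intro s hs
    obtain ⟨hs, h1⟩ := mem_wtSetsOne.mp hs
    obtain ⟨hc, hpos, hsum⟩ := mem_wtSets.mp hs
    rw [← add_sum_erase s _ h1] at hsum
    refine mem_filter.mpr ⟨mem_wtSets.mpr ⟨by rw [card_erase_of_mem h1, hc],
      fun i hi => hpos i (mem_of_mem_erase hi), by omega⟩, notMem_erase _ _⟩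
  · intro s hs t ht h
    rw [← insert_erase (mem_wtSetsOne.mp hs).2, ← insert_erase (mem_wtSetsOne.mp ht).2, h]
  · intro s hs
    obtain ⟨hs, h1⟩ := mem_filter.mp hs
    obtain ⟨hc, hpos, hsum⟩ := mem_wtSets.mp hs
    refine ⟨insert 1 s, mem_wtSetsOne.mpr ⟨mem_wtSets.mpr ⟨?_, ?_, ?_⟩, mem_insert_self _ _⟩,
      erase_insert h1⟩
    · rw [card_insert_of_notMem h1, hc]
    · simpa using hpos
    · rw [sum_insert h1, hsum, add_comm]

lemma card_wtPairs_succ (n : ℕ) :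
    (wtPairs (n + 1)).card = (wtPairs n).card + ((n - 2) / 2 - n / 3) := by
  have hsub : wtPairs n ⊆ wtPairs (n + 1) := by
    rintro ⟨a, b⟩ h
    rw [mem_wtPairs] at h ⊢
    omega
  rw [← card_sdiff_add_card_eq_card hsub, add_comm, ← Nat.card_Ioc]
  congr 1
  refine card_bij (fun p _ => p.2) ?_ ?_ ?_
  · rintro ⟨a, b⟩ h
    rw [mem_sdiff, mem_wtPairs, mem_wtPairs] at h
    rw [mem_Ioc]
    dsimp only
    omega
  · rintro ⟨a, b⟩ h ⟨a', b'⟩ h' (rfl : b = b')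
    rw [mem_sdiff, mem_wtPairs, mem_wtPairs] at h h'
    simp only [Prod.mk.injEq, and_true]
    omega
  · intro b hb
    rw [mem_Ioc] at hb
    refine ⟨(n - 2 * b, b), ?_, rfl⟩
    rw [mem_sdiff, mem_wtPairs, mem_wtPairs]
    omega

lemma card_wtSets_three (k : ℕ) :
    (wtSets 3 k).card =
      (wtSetsOne 3 k).card + (wtSetsOne 4 k).card + ((k - 3) / 2 - (k - 1) / 3) := by
  rw [← card_filter_add_card_filter_not (1 ∈ ·), card_wtSets_three_filter, add_assoc]
  congr 1
  cases k with
  | zero => rfl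
  | succ n => rw [card_wtSetsOne_four, card_wtPairs_succ, Nat.add_sub_cancel]; rfl

end Counting

section Monomials

lemma mono_singleton (a : ℕ) : mono K {a} = e K a := by
  simp [mono]

lemma mono_insert {a : ℕ} {s : Finset ℕ} (h : ∀ b ∈ s, a < b) :
    mono K (insert a s) = e K a * mono K s := by
  rw [mono, sort_insert _ (fun b hb => (h b hb).le) (fun ha => (h a ha).false), List.map_cons,
    List.prod_cons, mono]

lemma mono_pair {a b : ℕ} (hab : a < b) : mono K {a, b} = e K a * e K b := by
  rw [mono_insert K (by simpa using hab), mono_singleton]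

lemma mono_triple {a b c : ℕ} (hab : a < b) (hbc : b < c) :
    mono K {a, b, c} = e K a * (e K b * e K c) := by
  rw [mono_insert K (by simp [hab, hab.trans hbc]), mono_pair K hbc]

lemma mono_quadruple {a b c : ℕ} (ha : 1 < a) (hab : a < b) (hbc : b < c) :
    mono K {1, a, b, c} = e K 1 * (e K a * (e K b * e K c)) := by
  rw [mono_insert K (by simp [ha, ha.trans hab, (ha.trans hab).trans hbc]), mono_triple K hab hbc]

lemma mono_map_succ (t : Finset ℕ) :
    mono K (t.map (addRightEmbedding 1)) =
      (Finsupp.basisSingleOne (R := K) (ι := ℕ)).ExteriorAlgebra t := by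
  have hc : (t.map (addRightEmbedding 1)).card = t.card := card_map _
  have hu : (fun i => t.orderEmbOfFin rfl i + 1) = (t.map (addRightEmbedding 1)).orderEmbOfFin hc :=
    orderEmbOfFin_unique hc (fun i => mem_map_of_mem _ (orderEmbOfFin_mem t rfl i))
      fun i j hij => Nat.succ_lt_succ ((t.orderEmbOfFin rfl).strictMono hij)
  rw [ExteriorAlgebra.basis_apply_ofCard _ rfl, ExteriorAlgebra.ιMulti_family,
    ExteriorAlgebra.ιMulti_apply, mono,
    ← listMap_orderEmbOfFin_finRange _ hc, ← hu, List.map_map, List.ofFn_eq_map]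
  rfl

lemma linearIndepOn_mono : LinearIndepOn K (mono K) {s | ∀ i ∈ s, 1 ≤ i} := by
  have hli := (Finsupp.basisSingleOne (R := K) (ι := ℕ)).ExteriorAlgebra.linearIndependent
  have hrange : {s : Finset ℕ | ∀ i ∈ s, 1 ≤ i} =
      Set.range fun t : Finset ℕ => t.map (addRightEmbedding 1) := by
    ext s
    refine ⟨fun hs => ⟨s.image (· - 1), ?_⟩, ?_⟩
    · ext i
      simp only [mem_map, mem_image, addRightEmbedding_apply]
      constructor
      · rintro ⟨_, ⟨j, hj, rfl⟩, rfl⟩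
        rwa [Nat.sub_add_cancel (hs j hj)]
      · exact fun hi => ⟨i - 1, ⟨i, hi, rfl⟩, Nat.sub_add_cancel (hs i hi)⟩
    · rintro ⟨t, rfl⟩ i hi
      obtain ⟨j, -, rfl⟩ := mem_map.mp hi
      exact Nat.le_add_left 1 j
  rw [hrange, linearIndepOn_range_iff (map_injective _)]
  convert! hli using 1
  exact funext (mono_map_succ K)

lemma finrank_span_mono {F : Finset (Finset ℕ)} (hF : ∀ s ∈ F, ∀ i ∈ s, 1 ≤ i) :
    Module.finrank K (Submodule.span K (mono K '' (F : Set (Finset ℕ)))) = F.card := by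
  have h : LinearIndepOn K (mono K) (F : Set (Finset ℕ)) :=
    (linearIndepOn_mono K).mono hF
  rw [Set.image_eq_range]
  simpa using finrank_span_eq_card h

lemma LamWt_eq_span (q k : ℕ) :
    LamWt K q k = Submodule.span K (mono K '' (wtSets q k : Set (Finset ℕ))) := by
  rw [LamWt]
  congr 1
  ext x
  simp only [Set.mem_ofPred_eq, Set.mem_image, mem_coe, mem_wtSets, and_assoc, eq_comm]

lemma mono_mem_LamWt {q k : ℕ} {s : Finset ℕ} (hs : s ∈ wtSets q k) : mono K s ∈ LamWt K q k := by
  rw [LamWt_eq_span]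
  exact Submodule.subset_span ⟨s, hs, rfl⟩

lemma e_mem_LamDeg (a : ℕ) : e K a ∈ LamDeg K 1 := by
  rcases Nat.eq_zero_or_pos a with rfl | ha
  · exact Submodule.subset_span ⟨{1}, rfl, by simp, by rw [mono_singleton]; rfl⟩
  · exact Submodule.subset_span
      ⟨{a}, rfl, fun i hi => mem_singleton.mp hi ▸ ha, (mono_singleton K a).symm⟩

lemma e_mul_e_mul_self (a : ℕ) (x : ExteriorAlgebra K (ℕ →₀ K)) : e K a * (e K a * x) = 0 := by
  rw [← mul_assoc, e, ExteriorAlgebra.ι_sq_zero, zero_mul]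

lemma e_mul_self (a : ℕ) : e K a * e K a = 0 := ExteriorAlgebra.ι_sq_zero _

lemma e_mul_e_mul_swap (a b : ℕ) (x : ExteriorAlgebra K (ℕ →₀ K)) :
    e K a * (e K b * x) = -(e K b * (e K a * x)) := by
  rw [← mul_assoc, ← mul_assoc, ← neg_mul]
  congr 1
  exact eq_neg_of_add_eq_zero_left (ExteriorAlgebra.ι_add_mul_swap _ _)

end Monomials

section Differential

variable {K} {d : Module.End K (ExteriorAlgebra K (ℕ →₀ K))}

lemma differential_e_mul
    (hLeib : ∀ p : ℕ, ∀ x ∈ LamDeg K p, ∀ y,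
      d (x * y) = d x * y + ((-1 : K) ^ p) • (x * d y))
    (hd : ∀ a, d (e K a) = e K 1 * e K (a - 1)) (a : ℕ) (x : ExteriorAlgebra K (ℕ →₀ K)) :
    d (e K a * x) = e K 1 * (e K (a - 1) * x) - e K a * d x := by
  rw [hLeib 1 _ (e_mem_LamDeg K a), hd, pow_one, neg_one_smul, mul_assoc, sub_eq_add_neg]

lemma differential_e_mul_e (hd : ∀ a, d (e K a) = e K 1 * e K (a - 1))
    (hmul : ∀ a x, d (e K a * x) = e K 1 * (e K (a - 1) * x) - e K a * d x) (a b : ℕ) :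
    d (e K a * e K b) = e K 1 * (e K (a - 1) * e K b) + e K 1 * (e K a * e K (b - 1)) := by
  rw [hmul, hd, e_mul_e_mul_swap K a, sub_neg_eq_add]

lemma differential_e_mul_e_mul_e (hd : ∀ a, d (e K a) = e K 1 * e K (a - 1))
    (hmul : ∀ a x, d (e K a * x) = e K 1 * (e K (a - 1) * x) - e K a * d x) (a b c : ℕ) :
    d (e K a * (e K b * e K c)) = e K 1 * (e K (a - 1) * (e K b * e K c)) +
      e K 1 * (e K a * (e K (b - 1) * e K c)) + e K 1 * (e K a * (e K b * e K (c - 1))) := by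
  rw [hmul, differential_e_mul_e hd hmul, mul_add, e_mul_e_mul_swap K a 1,
    e_mul_e_mul_swap K a 1]
  abel

lemma map_differential_LamWt_two (hd : ∀ a, d (e K a) = e K 1 * e K (a - 1))
    (hmul : ∀ a x, d (e K a * x) = e K 1 * (e K (a - 1) * x) - e K a * d x) (k : ℕ) :
    (LamWt K 2 k).map d = Submodule.span K (mono K '' (wtSetsOne 3 k : Set (Finset ℕ))) := by
  apply le_antisymm
  · have key : ∀ a b, a ≤ b → a + b + 1 = k → e K 1 * (e K a * e K b) ∈
        Submodule.span K (mono K '' (wtSetsOne 3 k : Set (Finset ℕ))) := by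
      intro a b hab h
      rcases hab.eq_or_lt with rfl | hab
      · simp [e_mul_self]
      obtain rfl | rfl | ha : a = 0 ∨ a = 1 ∨ 1 < a := by omega
      · rw [show e K 0 = e K 1 from rfl, e_mul_e_mul_self]
        exact zero_mem _
      · rw [e_mul_e_mul_self]
        exact zero_mem _
      · rw [← mono_triple K ha hab]
        exact Submodule.subset_span ⟨_, mem_wtSetsOne.mpr
          ⟨triple_mem_wtSets le_rfl ha hab (by omega), mem_insert_self _ _⟩, rfl⟩
    rw [LamWt_eq_span, Submodule.map_span_le]
    rintro _ ⟨s, hs, rfl⟩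
    obtain ⟨hc, hpos, hsum⟩ := mem_wtSets.mp hs
    obtain ⟨a, b, hab, rfl⟩ := exists_lt_of_card_eq_two hc
    rw [sum_pair hab.ne] at hsum
    have := hpos a (by simp)
    rw [mono_pair K hab, differential_e_mul_e hd hmul]
    exact add_mem (key _ _ (by omega) (by omega)) (key _ _ (by omega) (by omega))
  · have key : ∀ a b, a < b → a + b + 1 = k →
        e K 1 * (e K a * e K b) ∈ (LamWt K 2 k).map d := by
      intro a
      induction a with
      | zero =>
        intro b _ _
        rw [show e K 0 = e K 1 from rfl, e_mul_e_mul_self]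
        exact zero_mem _
      | succ a ih =>
        intro b hab h
        have hmem : d (e K (a + 1) * e K (b + 1)) ∈ (LamWt K 2 k).map d := by
          rw [← mono_pair K (by omega)]
          refine Submodule.mem_map_of_mem (mono_mem_LamWt K (mem_wtSets.mpr
            ⟨card_pair (by omega), by simp, ?_⟩))
          rw [sum_pair (by omega)]
          omega
        rw [differential_e_mul_e hd hmul] at hmem
        exact (Submodule.add_mem_iff_right _ (ih (b + 1) (by omega) (by omega))).mp hmem
    rw [Submodule.span_le]
    rintro _ ⟨s, hs, rfl⟩
    obtain ⟨a, b, ha, hab, h, rfl⟩ := exists_of_mem_wtSetsOne_three hs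
    rw [mono_triple K ha hab]
    exact key a b hab h

lemma map_differential_LamWt_three (hd : ∀ a, d (e K a) = e K 1 * e K (a - 1))
    (hmul : ∀ a x, d (e K a * x) = e K 1 * (e K (a - 1) * x) - e K a * d x) (k : ℕ) :
    (LamWt K 3 k).map d = Submodule.span K (mono K '' (wtSetsOne 4 k : Set (Finset ℕ))) := by
  have hzero : ∀ a b c, a ≤ 1 ∨ a = b ∨ b = c → e K 1 * (e K a * (e K b * e K c)) = 0 := by
    rintro a b c (h | rfl | rfl)
    · have : e K a = e K 1 := by rw [e, e, Nat.sub_eq_zero_of_le h]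
      rw [this, e_mul_e_mul_self]
    · rw [e_mul_e_mul_self, mul_zero]
    · rw [e_mul_self, mul_zero, mul_zero]
  apply le_antisymm
  · have key : ∀ a b c, a ≤ b → b ≤ c → a + b + c + 1 = k → e K 1 * (e K a * (e K b * e K c)) ∈
        Submodule.span K (mono K '' (wtSetsOne 4 k : Set (Finset ℕ))) := by
      intro a b c hab hbc h
      by_cases h0 : a ≤ 1 ∨ a = b ∨ b = c
      · rw [hzero a b c h0]
        exact zero_mem _
      · rw [← mono_quadruple K (by omega) (by omega) (by omega)]
        exact Submodule.subset_span
          ⟨_, quadruple_mem_wtSetsOne (by omega) (by omega) (by omega) h, rfl⟩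
    rw [LamWt_eq_span, Submodule.map_span_le]
    rintro _ ⟨s, hs, rfl⟩
    obtain ⟨hc, hpos, hsum⟩ := mem_wtSets.mp hs
    obtain ⟨a, b, c, hab, hbc, rfl⟩ := exists_lt_lt_of_card_eq_three hc
    rw [sum_triple hab hbc] at hsum
    have := hpos a (by simp)
    rw [mono_triple K hab hbc, differential_e_mul_e_mul_e hd hmul]
    exact add_mem (add_mem (key _ _ _ (by omega) (by omega) (by omega))
      (key _ _ _ (by omega) (by omega) (by omega))) (key _ _ _ (by omega) (by omega) (by omega))
  · have key : ∀ n a b c, a + b = n → a ≤ b → b ≤ c → a + b + c + 1 = k →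
        e K 1 * (e K a * (e K b * e K c)) ∈ (LamWt K 3 k).map d := by
      intro n
      induction n with
      | zero =>
        intro a b c hn _ _ _
        rw [hzero a b c (by omega)]
        exact zero_mem _
      | succ n ih =>
        intro a b c hn hab hbc h
        by_cases h0 : a ≤ 1 ∨ a = b ∨ b = c
        · rw [hzero a b c h0]
          exact zero_mem _
        have hmem : d (e K a * (e K b * e K (c + 1))) ∈ (LamWt K 3 k).map d := by
          rw [← mono_triple K (by omega) (by omega)]
          exact Submodule.mem_map_of_mem (mono_mem_LamWt K
            (triple_mem_wtSets (by omega) (by omega) (by omega) (by omega)))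
        rw [differential_e_mul_e_mul_e hd hmul] at hmem
        exact (Submodule.add_mem_iff_right _
          (add_mem (ih (a - 1) b (c + 1) (by omega) (by omega) (by omega) (by omega))
            (ih a (b - 1) (c + 1) (by omega) (by omega) (by omega) (by omega)))).mp hmem
    rw [Submodule.span_le]
    rintro _ ⟨s, hs, rfl⟩
    obtain ⟨a, b, c, ha, hab, hbc, h, rfl⟩ := exists_of_mem_wtSetsOne_four hs
    rw [mono_quadruple K ha hab hbc]
    exact key _ a b c rfl hab.le hbc.le h

end Differential

lemma finrank_map_add_finrank_inf_ker {F V W : Type*} [Field F] [AddCommGroup V] [Module F V]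
    [AddCommGroup W] [Module F W] (f : V →ₗ[F] W) (p : Submodule F V) [FiniteDimensional F p] :
    Module.finrank F (p.map f) + Module.finrank F ↥(p ⊓ LinearMap.ker f) = Module.finrank F p := by
  rw [← LinearMap.finrank_range_add_finrank_ker (f.domRestrict p), LinearMap.range_domRestrict,
    LinearMap.ker_domRestrict, ← Submodule.map_comap_subtype,
    Submodule.finrank_map_subtype_eq]

lemma finrank_inf_ker_sub_finrank_map {d : Module.End K (ExteriorAlgebra K (ℕ →₀ K))}
    (hd : ∀ a, d (e K a) = e K 1 * e K (a - 1))
    (hmul : ∀ a x, d (e K a * x) = e K 1 * (e K (a - 1) * x) - e K a * d x) (k : ℕ) :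
    Module.finrank K ↥(LamWt K 3 k ⊓ LinearMap.ker d) -
      Module.finrank K ↥((LamWt K 2 k).map d) = (k - 3) / 2 - (k - 1) / 3 := by
  have : FiniteDimensional K (LamWt K 3 k) := by
    rw [LamWt_eq_span]
    exact FiniteDimensional.span_of_finite K ((wtSets 3 k).finite_toSet.image _)
  have hpos : ∀ q, ∀ s ∈ wtSets q k, ∀ i ∈ s, 1 ≤ i := fun q s hs => (mem_wtSets.mp hs).2.1
  have hposOne : ∀ q, ∀ s ∈ wtSetsOne q k, ∀ i ∈ s, 1 ≤ i :=
    fun q s hs => hpos q s (mem_wtSetsOne.mp hs).1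
  have hrank := finrank_map_add_finrank_inf_ker d (LamWt K 3 k)
  have h3 : Module.finrank K (LamWt K 3 k) = (wtSets 3 k).card := by
    rw [LamWt_eq_span, finrank_span_mono K (hpos 3)]
  rw [h3, map_differential_LamWt_three hd hmul, finrank_span_mono K (hposOne 4)] at hrank
  rw [map_differential_LamWt_two hd hmul, finrank_span_mono K (hposOne 3)]
  have := card_wtSets_three k
  omega

/-- `dim H^3_k(m₀) = 0` for `k < 9`; and for `k = 6l + r ≥ 9` (`0 ≤ r < 6`),
`dim H^3_k(m₀) = l` if `r ∈ {3, 5}` and `l - 1` if `r ∈ {0, 1, 2, 4}`.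
Here `d` is the Chevalley–Eilenberg differential of `m₀`. -/
theorem stmt10 (d : Module.End K (ExteriorAlgebra K (ℕ →₀ K)))
    (hLeib : ∀ p : ℕ, ∀ x ∈ LamDeg K p, ∀ y,
      d (x * y) = d x * y + ((-1 : K) ^ p) • (x * d y))
    (h1 : d (e K 1) = 0) (h2 : d (e K 2) = 0)
    (hd : ∀ i, 2 ≤ i → d (e K (i + 1)) = e K 1 * e K i) :
    (∀ k, k < 9 →
      Module.finrank K ↥(LamWt K 3 k ⊓ LinearMap.ker d) -
        Module.finrank K ↥((LamWt K 2 k).map d) = 0) ∧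
    (∀ l r : ℕ, r < 6 → 9 ≤ 6 * l + r →
      Module.finrank K ↥(LamWt K 3 (6 * l + r) ⊓ LinearMap.ker d) -
        Module.finrank K ↥((LamWt K 2 (6 * l + r)).map d) =
          if r = 3 ∨ r = 5 then l else l - 1) := by
  have he : ∀ a, d (e K a) = e K 1 * e K (a - 1) := by
    intro a
    match a with
    | 0 => rw [show e K 0 = e K 1 from rfl, h1]; exact (e_mul_self K 1).symm
    | 1 => rw [h1]; exact (e_mul_self K 1).symm
    | 2 => rw [h2]; exact (e_mul_self K 1).symm
    | a + 3 => exact hd (a + 2) (by omega)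
  have key := finrank_inf_ker_sub_finrank_map K he (differential_e_mul hLeib he)
  refine ⟨fun k hk => ?_, fun l r hr hlr => ?_⟩
  · rw [key]
    omega
  · rw [key]
    split_ifs <;> omega
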